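/- arXiv:1407.2640 — 5 statements merged into one kernel-verified Lean document; each statement's English description precedes it below -/
import Mathlib

section
/- Let M be an (ε,δ)-differentially private mechanism (ε, δ ≥ 0) that takes as input a profile of n student records (each record consisting of a reported strict preference order over U ∪ {⊙} and the student's score vector (q_u(a))_{u∈U}) and outputs a probability distribution over threshold vectors t ∈ ℝ^U, where two profiles are neighboring if they differ in at most one student's record. Fix any profile ≻ of reports, any student a, any utility function v_a : U ∪ {⊙} → [0,1] consistent with the true preference order ≻_a of a, and any alternative report ≻'_a ≠ ≻_a. Then E_{t ∼ M(≻)}[ v_a( best_{≻_a}(t, a) ) ] ≥ E_{t ∼ M(≻'_a, ≻_{−a})}[ v_a( best_{≻'_a}(t, a) ) ] − (ε + δ), where best_{≻}(t, a) denotes the ≻-greatest element of {u ∈ U : q_u(a) ≥ t_u} ∪ {⊙}. In other words, composing any (ε,δ)-differentially private threshold-computing mechanism with the induced matching makes truthful reporting an (ε+δ)-approximately dominant strategy for every student. -/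
/-- If `P S ≤ c * Q S + δ` for every event `S`, then the same bound holds for expectations of
`[0,1]`-valued functions. -/
theorem sum_mul_le_of_forall_sum_le {R : Type*} [Fintype R] {P Q f : R → ℝ} {c δ : ℝ}
    (h : ∀ S : Finset R, ∑ r ∈ S, P r ≤ c * ∑ r ∈ S, Q r + δ)
    (hf0 : ∀ r, 0 ≤ f r) (hf1 : ∀ r, f r ≤ 1) :
    ∑ r, P r * f r ≤ c * ∑ r, Q r * f r + δ := by
  classical
  have hpos : ∑ r, (P r - c * Q r) * f r ≤ ∑ r with 0 < P r - c * Q r, (P r - c * Q r) := by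
    rw [Finset.sum_filter]
    refine Finset.sum_le_sum fun r _ => ?_
    split_ifs with hr
    · exact mul_le_of_le_one_right hr.le (hf1 r)
    · exact mul_nonpos_of_nonpos_of_nonneg (not_lt.mp hr) (hf0 r)
  have hS := h {r | 0 < P r - c * Q r}
  rw [Finset.sum_sub_distrib, ← Finset.mul_sum] at hpos
  have hsplit : ∑ r, (P r - c * Q r) * f r = ∑ r, P r * f r - c * ∑ r, Q r * f r := by
    rw [Finset.mul_sum, ← Finset.sum_sub_distrib]
    exact Finset.sum_congr rfl fun r _ => by ring
  linarith

/-- A multiplicative bound `x ≤ exp ε * y + δ` on numbers `x ≤ 1` gives the additive bound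
`x - (ε + δ) ≤ y`. -/
theorem sub_le_of_le_exp_mul_add {ε δ x y : ℝ} (hε : 0 ≤ ε) (hδ : 0 ≤ δ) (hx0 : 0 ≤ x)
    (hx1 : x ≤ 1) (h : x ≤ Real.exp ε * y + δ) : x - (ε + δ) ≤ y := by
  have hlow : 1 - ε ≤ Real.exp (-ε) := by linarith [Real.add_one_le_exp (-ε)]
  have hup : Real.exp (-ε) ≤ 1 := Real.exp_le_one_iff.mpr (by linarith)
  have hmul := mul_le_mul_of_nonneg_left h (Real.exp_pos (-ε)).le
  have hinv : Real.exp (-ε) * Real.exp ε = 1 := by rw [← Real.exp_add]; simp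
  rw [mul_add, ← mul_assoc, hinv, one_mul] at hmul
  nlinarith [mul_le_mul_of_nonneg_right hlow hx0, mul_le_mul_of_nonneg_right hup hδ,
    mul_le_mul_of_nonneg_left hx1 hε]

/-- Composing any `(ε,δ)`-differentially private threshold-computing
mechanism with the induced matching makes truthful reporting an `(ε+δ)`-approximately
dominant strategy for every student.  Student records consist of a reported strict
preference order over `U ∪ {⊙}` (encoded as a relation on `Option U`) together with
the student's score vector; profiles are neighboring when they differ in at most one
student's record.  The mechanism `M` outputs a distribution over a finite range `R`,
where each outcome `r` is interpreted as the threshold vector `thresh r`.  For a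
reported order `p` and thresholds `t`, `best p t` is the `p`-greatest element of
`{u : q_u(a) ≥ t_u} ∪ {⊙}` (for the fixed student `a` with scores `q`). -/
theorem stmt_1 {A U R : Type*} [Fintype R] [Nonempty R] [Fintype U] [DecidableEq A]
    (ε δ : ℝ) (hε : 0 ≤ ε) (hδ : 0 ≤ δ)
    (M : (A → (Option U → Option U → Prop) × (U → ℝ)) → R → ℝ)
    (thresh : R → U → ℝ)
    (hMnonneg : ∀ D r, 0 ≤ M D r) (hMsum : ∀ D, ∑ r, M D r = 1)
    -- (ε,δ)-differential privacy w.r.t. changing one student's record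
    (hDP : ∀ D D' : A → (Option U → Option U → Prop) × (U → ℝ),
      (∃ a₀, ∀ a, a ≠ a₀ → D a = D' a) →
      ∀ S : Finset R, ∑ r ∈ S, M D r ≤ Real.exp ε * ∑ r ∈ S, M D' r + δ)
    -- the profile of reports, the fixed student, her true order and scores
    (Prof : A → (Option U → Option U → Prop) × (U → ℝ))
    (a : A)
    (tru : Option U → Option U → Prop) (q : U → ℝ)
    (htruth : Prof a = (tru, q))
    (htso : IsStrictTotalOrder (Option U) tru)
    -- an alternative (untruthful) report
    (rep : Option U → Option U → Prop) (hrep : rep ≠ tru)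
    -- `best p t` : the p-greatest available option for student a under thresholds t
    (best : (Option U → Option U → Prop) → (U → ℝ) → Option U)
    (hbest : ∀ p : Option U → Option U → Prop, (p = tru ∨ p = rep) → ∀ t : U → ℝ,
      (best p t = none ∨ ∃ u, best p t = some u ∧ q u ≥ t u) ∧
      ∀ x : Option U, (x = none ∨ ∃ u, x = some u ∧ q u ≥ t u) →
        x ≠ best p t → p (best p t) x)
    -- any cardinal utility in [0,1] consistent with the true preferences
    (v : Option U → ℝ) (hv0 : ∀ x, 0 ≤ v x) (hv1 : ∀ x, v x ≤ 1)
    (hcons : ∀ x y : Option U, v x ≥ v y ↔ (x = y ∨ tru x y)) :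
    ∑ r, M Prof r * v (best tru (thresh r)) ≥
      ∑ r, M (Function.update Prof a (rep, q)) r * v (best rep (thresh r))
        - (ε + δ) := by
  have hle : ∀ r, v (best rep (thresh r)) ≤ v (best tru (thresh r)) := fun r => by
    refine (hcons _ _).mpr ?_
    by_cases he : best rep (thresh r) = best tru (thresh r)
    · exact Or.inl he.symm
    · exact Or.inr ((hbest tru (Or.inl rfl) _).2 _ (hbest rep (Or.inr rfl) _).1 he)
  have hexp := sum_mul_le_of_forall_sum_le (f := fun r => v (best rep (thresh r)))
    (hDP (Function.update Prof a (rep, q)) Prof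
      ⟨a, fun b hb => Function.update_of_ne hb _ _⟩)
    (fun r => hv0 _) (fun r => hv1 _)
  have hx0 : 0 ≤ ∑ r, M (Function.update Prof a (rep, q)) r * v (best rep (thresh r)) :=
    Finset.sum_nonneg fun r _ => mul_nonneg (hMnonneg _ _) (hv0 _)
  have hx1 : ∑ r, M (Function.update Prof a (rep, q)) r * v (best rep (thresh r)) ≤ 1 := by
    rw [← hMsum (Function.update Prof a (rep, q))]
    exact Finset.sum_le_sum fun r _ => mul_le_of_le_one_right (hMnonneg _ _) (hv1 _)
  exact (sub_le_of_le_exp_mul_add hε hδ hx0 hx1 hexp).trans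
    (Finset.sum_le_sum fun r _ => mul_le_mul_of_nonneg_left (hle r) (hMnonneg _ _))
end

section
/- Let P_t ⊆ P ⊆ A × U be two proposal sets such that for every school u, the set P_t(u) is an upper set of P(u) with respect to u's scores: if a ∈ P_t(u), a' ∈ P(u), and q_u(a') > q_u(a), then a' ∈ P_t(u) (i.e., each school's earlier proposals form a prefix of its later proposals in decreasing order of score). Then for every school u, every student a with μ_{P_t}(a) = u and μ_P(a) ≠ u, and every student a' with μ_P(a') = u and μ_{P_t}(a') ≠ u, we have q_u(a) > q_u(a'). In particular, any intermediate matching arising in a run of the school-proposing deferred acceptance algorithm is school-dominant relative to the final (school-optimal) matching: compared with the final matching, each school may be matched to fewer students but every student it loses is preferred by it to every student it gains. -/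
/-- Let `Pt ⊆ P` be proposal sets such that each school's proposals in
`Pt` form an upper set of its proposals in `P` with respect to its scores.  Then for
every school `u`, every student `a` that `u` has under `μ_{Pt}` but not under `μ_P`,
and every student `a'` that `u` has under `μ_P` but not under `μ_{Pt}`, we have
`q_u(a) > q_u(a')`: intermediate matchings of school-proposing deferred acceptance
are school-dominant relative to the final matching. -/
theorem stmt_3 {A U : Type*}
    (pref : A → Option U → Option U → Prop)
    (hpref : ∀ a, IsStrictTotalOrder (Option U) (pref a))
    (q : U → A → ℝ)
    (hqinj : ∀ u a a', q u a = q u a' → a = a')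
    (Pt P : Set (A × U)) (hsub : Pt ⊆ P)
    (hupper : ∀ (u : U) (a a' : A),
      (a, u) ∈ Pt → (a', u) ∈ P → q u a' > q u a → (a', u) ∈ Pt)
    (μPt μP : A → Option U)
    (hμPt : ∀ a, (μPt a = none ∨ ∃ u, μPt a = some u ∧ (a, u) ∈ Pt) ∧
      ∀ x : Option U, (x = none ∨ ∃ u, x = some u ∧ (a, u) ∈ Pt) →
        x ≠ μPt a → pref a (μPt a) x)
    (hμP : ∀ a, (μP a = none ∨ ∃ u, μP a = some u ∧ (a, u) ∈ P) ∧
      ∀ x : Option U, (x = none ∨ ∃ u, x = some u ∧ (a, u) ∈ P) →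
        x ≠ μP a → pref a (μP a) x)
    (u : U) (a a' : A)
    (ha₁ : μPt a = some u) (ha₂ : μP a ≠ some u)
    (ha'₁ : μP a' = some u) (ha'₂ : μPt a' ≠ some u) :
    q u a > q u a' := by
  have hau : (a, u) ∈ Pt := by
    rcases (hμPt a).1 with h | ⟨v, h, hv⟩ <;> simp_all
  have hau' : (a', u) ∈ P := by
    rcases (hμP a').1 with h | ⟨v, h, hv⟩ <;> simp_all
  by_contra! hle
  have hne : q u a ≠ q u a' := fun h => ha'₂ (hqinj u a a' h ▸ ha₁)
  have hmem : (a', u) ∈ Pt := hupper u a a' hau hau' (lt_of_le_of_ne hle hne)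
  have hearly : pref a' (μPt a') (some u) :=
    (hμPt a').2 _ (Or.inr ⟨u, rfl, hmem⟩) (Ne.symm ha'₂)
  have hlate : pref a' (some u) (μPt a') := by
    rw [← ha'₁]
    exact (hμP a').2 _ ((hμPt a').1.imp_right fun ⟨v, hv, hvt⟩ => ⟨v, hv, hsub hvt⟩)
      (ha'₁ ▸ ha'₂)
  have := hpref a'
  exact irrefl_of (pref a') _ (trans_of (pref a') hearly hlate)
end

section
/- Let 0 ≤ α ≤ 1 and let μ be a feasible and α-approximately stable matching with respect to capacities (C_u)_{u∈U}. Then there exist capacities (C'_u)_{u∈U} with (1−α)·C_u ≤ C'_u ≤ C_u for every school u such that μ is feasible and exactly stable (0-approximately stable) with respect to the capacities (C'_u). That is, an α-approximately stable matching is an exactly stable matching in a market in which each school's capacity is reduced by at most a (1−α) factor. -/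
/-- An `α`-approximately stable matching (`0 ≤ α ≤ 1`) with respect to
capacities `C` is exactly stable with respect to some reduced capacities `C'` with
`(1−α)·C_u ≤ C'_u ≤ C_u` for every school `u`. -/
theorem stmt_6 {A U : Type*} [Fintype A] [DecidableEq U]
    (pref : A → Option U → Option U → Prop)
    (hpref : ∀ a, IsStrictTotalOrder (Option U) (pref a))
    (q : U → A → ℝ)
    (acceptable : U → A → Prop)
    (C : U → ℕ)
    (α : ℝ) (hα0 : 0 ≤ α) (hα1 : α ≤ 1)
    (μ : A → Option U)
    -- feasibility
    (hfeas : ∀ u, (Finset.univ.filter fun a => μ a = some u).card ≤ C u)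
    -- no blocking pairs with filled seats
    (hfilled : ∀ a u, μ a ≠ some u →
      pref a (μ a) (some u) ∨ ∀ a', μ a' = some u → q u a' > q u a)
    -- no blocking pairs with empty seats at under-enrolled schools
    (hempty : ∀ u,
      ((Finset.univ.filter fun a => μ a = some u).card : ℝ) < (1 - α) * C u →
      ∀ a, acceptable u a → μ a ≠ some u → pref a (μ a) (some u)) :
    ∃ C' : U → ℕ,
      (∀ u, (1 - α) * C u ≤ (C' u : ℝ) ∧ C' u ≤ C u) ∧
      -- feasibility w.r.t. C'
      (∀ u, (Finset.univ.filter fun a => μ a = some u).card ≤ C' u) ∧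
      -- no blocking pairs with filled seats (unchanged)
      (∀ a u, μ a ≠ some u →
        pref a (μ a) (some u) ∨ ∀ a', μ a' = some u → q u a' > q u a) ∧
      -- exact stability (α = 0) w.r.t. C'
      (∀ u, ((Finset.univ.filter fun a => μ a = some u).card : ℝ) < C' u →
        ∀ a, acceptable u a → μ a ≠ some u → pref a (μ a) (some u)) := by
  refine ⟨fun u => max ⌈(1 - α) * C u⌉₊ (Finset.univ.filter fun a => μ a = some u).card,
    fun u => ⟨?_, max_le (Nat.ceil_le.mpr ?_) (hfeas u)⟩, fun u => le_max_right _ _, hfilled,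
    fun u hu => hempty u ?_⟩
  · exact (Nat.le_ceil _).trans (Nat.cast_le.mpr (le_max_left _ _))
  · exact mul_le_of_le_one_left (Nat.cast_nonneg _) (by linarith)
  · exact Nat.lt_ceil.mp ((lt_max_iff.mp (Nat.cast_lt.mp hu)).resolve_right (lt_irrefl _))
end

section
/- Fix k ≥ 1 and consider the market with 2k students s_1,…,s_{2k} and two schools H and Y, each with capacity k and finding every student acceptable. For i ≤ k, student s_i has preferences H ≻ Y ≻ ⊙; for i > k, student s_i has preferences Y ≻ H ≻ ⊙. School Y's scores satisfy q_Y(s_1) > q_Y(s_2) > … > q_Y(s_{2k}), and school H's scores satisfy q_H(s_{k+1}) > q_H(s_{k+2}) > … > q_H(s_{2k}) > q_H(s_1) > … > q_H(s_k). Then the matching μ defined by μ(s_i) = Y for i ≤ k and μ(s_i) = H for i > k is feasible and exactly stable. -/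
/-- The two schools of the example market. -/
inductive School where
  | H : School
  | Y : School
  deriving DecidableEq

open School

/-- Under the matching that sends the first `k` of `2k` students to `Y` and the others to `H`,
each school receives exactly `k` students. -/
theorem card_filter_eq_of_split (k : ℕ) (μ : Fin (2 * k) → Option School)
    (hμ : ∀ i, μ i = if i.val < k then some Y else some H) (u : School) :
    (Finset.univ.filter fun i => μ i = some u).card = k := by
  have hlt : (Finset.univ.filter fun i : Fin (2 * k) => i.val < k).card = k := by
    rw [Fin.card_filter_val_lt]
    omega
  cases u with
  | Y =>
    have h : ∀ i, μ i = some Y ↔ i.val < k := fun i => by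
      rw [hμ]; split_ifs <;> simp_all
    simpa only [h] using hlt
  | H =>
    have h : ∀ i, μ i = some H ↔ ¬ i.val < k := fun i => by
      rw [hμ]; split_ifs <;> simp_all
    have hsum := Finset.card_filter_add_card_filter_not
      (s := (Finset.univ : Finset (Fin (2 * k)))) (fun i => i.val < k)
    rw [Finset.card_univ, Fintype.card_fin, hlt] at hsum
    simp only [h]
    omega

/-- In the market with `2k` students `s_1, …, s_{2k}` (indexed by
`Fin (2k)`, student `s_{i+1}` having index `i`) and two schools `H, Y`, each with
capacity `k` and finding every student acceptable, where students `s_1,…,s_k` have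
preferences `H ≻ Y ≻ ⊙`, students `s_{k+1},…,s_{2k}` have preferences `Y ≻ H ≻ ⊙`,
`Y`'s scores are decreasing in the index, and `H`'s scores satisfy
`q_H(s_{k+1}) > … > q_H(s_{2k}) > q_H(s_1) > … > q_H(s_k)`, the matching `μ` sending
`s_i ↦ Y` for `i ≤ k` and `s_i ↦ H` for `i > k` is feasible and exactly stable. -/
theorem stmt_7 (k : ℕ) (hk : 1 ≤ k)
    (pref : Fin (2 * k) → Option School → Option School → Prop)
    (hpref : ∀ i, IsStrictTotalOrder (Option School) (pref i))
    (hprefH : ∀ i : Fin (2 * k), i.val < k →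
      pref i (some H) (some Y) ∧ pref i (some Y) none)
    (hprefY : ∀ i : Fin (2 * k), k ≤ i.val →
      pref i (some Y) (some H) ∧ pref i (some H) none)
    (q : School → Fin (2 * k) → ℝ)
    (hqY : ∀ i j : Fin (2 * k), i < j → q Y i > q Y j)
    (hqH₁ : ∀ i j : Fin (2 * k), k ≤ i.val → k ≤ j.val → i < j → q H i > q H j)
    (hqH₂ : ∀ i j : Fin (2 * k), k ≤ i.val → j.val < k → q H i > q H j)
    (hqH₃ : ∀ i j : Fin (2 * k), i.val < k → j.val < k → i < j → q H i > q H j)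
    (μ : Fin (2 * k) → Option School)
    (hμ : ∀ i, μ i = if i.val < k then some Y else some H) :
    -- feasibility (each school has capacity k)
    (∀ u : School, (Finset.univ.filter fun i => μ i = some u).card ≤ k) ∧
    -- no blocking pairs with filled seats
    (∀ (i : Fin (2 * k)) (u : School), μ i ≠ some u →
      pref i (μ i) (some u) ∨ ∀ j, μ j = some u → q u j > q u i) ∧
    -- no blocking pairs with empty seats (every student is acceptable)
    (∀ u : School, (Finset.univ.filter fun i => μ i = some u).card < k →
      ∀ i, μ i ≠ some u → pref i (μ i) (some u)) := by
  have hcard := card_filter_eq_of_split k μ hμ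
  have hY : ∀ i, μ i = some Y ↔ i.val < k := fun i => by
    rw [hμ]; split_ifs <;> simp_all
  have hH : ∀ i, μ i = some H ↔ k ≤ i.val := fun i => by
    rw [hμ, ← not_lt]; split_ifs <;> simp_all
  refine ⟨fun u => (hcard u).le, fun i u hu => Or.inr fun j hj => ?_,
    fun u hu => absurd (hcard u) hu.ne⟩
  cases u with
  | H =>
    rw [Ne, hH, not_le] at hu
    exact hqH₂ j i ((hH j).1 hj) hu
  | Y =>
    rw [Ne, hY, not_lt] at hu
    exact hqY j i (Fin.lt_def.2 (((hY j).1 hj).trans_le hu))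
end

section
/- Fix k ≥ 1 and consider the market with students s_2,…,s_{2k} (i.e., the market of the previous instance with student s_1 removed) and two schools H and Y, each with capacity k and finding every student acceptable. For 2 ≤ i ≤ k, student s_i has preferences H ≻ Y ≻ ⊙; for i > k, student s_i has preferences Y ≻ H ≻ ⊙. School Y's scores satisfy q_Y(s_2) > … > q_Y(s_{2k}), and school H's scores satisfy q_H(s_{k+1}) > … > q_H(s_{2k}) > q_H(s_2) > … > q_H(s_k). Then the matching μ' defined by μ'(s_i) = H for 2 ≤ i ≤ k and μ'(s_i) = Y for i > k is the unique feasible and exactly stable matching of this market. Moreover, μ'(s_i) ≠ μ(s_i) for every student s_i with i ≥ 2, where μ is the stable matching of the full 2k-student instance given by μ(s_i) = Y for i ≤ k and μ(s_i) = H for i > k: removing a single student changes the match of every remaining student. -/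
open School

/-- Among the indices `1, …, 2k - 1`, exactly `k` are at least `k`. -/
lemma card_filter_le_index (k : ℕ) (hk : 1 ≤ k) :
    (Finset.univ.filter fun i : {i : Fin (2 * k) // i.val ≠ 0} => k ≤ i.val.val).card = k := by
  have hinj : Function.Injective fun i : {i : Fin (2 * k) // i.val ≠ 0} => i.val.val :=
    Fin.val_injective.comp Subtype.val_injective
  rw [← Finset.card_image_of_injective _ hinj]
  have himage : (Finset.univ.filter fun i : {i : Fin (2 * k) // i.val ≠ 0} =>
      k ≤ i.val.val).image (fun i => i.val.val) = Finset.Ico k (2 * k) := by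
    ext n
    simp only [Finset.mem_image, Finset.mem_filter, Finset.mem_univ, true_and, Finset.mem_Ico]
    constructor
    · rintro ⟨i, hi, rfl⟩
      exact ⟨hi, i.val.isLt⟩
    · rintro ⟨h₁, h₂⟩
      exact ⟨⟨⟨n, h₂⟩, by simp only; omega⟩, h₁, rfl⟩
  rw [himage, Nat.card_Ico]
  omega

/-- Among the indices `1, …, 2k - 1`, fewer than `k` are below `k`. -/
lemma card_filter_index_lt (k : ℕ) (hk : 1 ≤ k) :
    (Finset.univ.filter fun i : {i : Fin (2 * k) // i.val ≠ 0} => i.val.val < k).card < k := by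
  have hinj : Function.Injective fun i : {i : Fin (2 * k) // i.val ≠ 0} => i.val.val :=
    Fin.val_injective.comp Subtype.val_injective
  rw [← Finset.card_image_of_injective _ hinj]
  have hsub : (Finset.univ.filter fun i : {i : Fin (2 * k) // i.val ≠ 0} =>
      i.val.val < k).image (fun i => i.val.val) ⊆ Finset.Ico 1 k := by
    intro n
    simp only [Finset.mem_image, Finset.mem_filter, Finset.mem_univ, true_and, Finset.mem_Ico]
    rintro ⟨i, hi, rfl⟩
    exact ⟨Nat.one_le_iff_ne_zero.mpr i.property, hi⟩
  have := Finset.card_le_card hsub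
  rw [Nat.card_Ico] at this
  omega

/-- Remove student `s_1` (index `0`) from the market of Statement 7;
the remaining students are indexed by the subtype `{i : Fin (2k) // i.val ≠ 0}`.
Each of the two schools `H, Y` has capacity `k` and finds every student acceptable;
students `s_2,…,s_k` have preferences `H ≻ Y ≻ ⊙`, students `s_{k+1},…,s_{2k}` have
preferences `Y ≻ H ≻ ⊙`, `Y`'s scores are decreasing in the index, and `H`'s scores
satisfy `q_H(s_{k+1}) > … > q_H(s_{2k}) > q_H(s_2) > … > q_H(s_k)`.  Then the
matching `μ'` sending `s_i ↦ H` for `2 ≤ i ≤ k` and `s_i ↦ Y` for `i > k` is the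
unique feasible and exactly stable matching, and it differs from the stable matching
`μ` of the full market (`s_i ↦ Y` for `i ≤ k`, `s_i ↦ H` for `i > k`) on every
remaining student. -/
theorem stmt_9 (k : ℕ) (hk : 1 ≤ k)
    (pref : {i : Fin (2 * k) // i.val ≠ 0} → Option School → Option School → Prop)
    (hpref : ∀ i, IsStrictTotalOrder (Option School) (pref i))
    (hprefH : ∀ i : {i : Fin (2 * k) // i.val ≠ 0}, i.val.val < k →
      pref i (some H) (some Y) ∧ pref i (some Y) none)
    (hprefY : ∀ i : {i : Fin (2 * k) // i.val ≠ 0}, k ≤ i.val.val →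
      pref i (some Y) (some H) ∧ pref i (some H) none)
    (q : School → {i : Fin (2 * k) // i.val ≠ 0} → ℝ)
    (hqY : ∀ i j : {i : Fin (2 * k) // i.val ≠ 0}, i.val < j.val → q Y i > q Y j)
    (hqH₁ : ∀ i j : {i : Fin (2 * k) // i.val ≠ 0},
      k ≤ i.val.val → k ≤ j.val.val → i.val < j.val → q H i > q H j)
    (hqH₂ : ∀ i j : {i : Fin (2 * k) // i.val ≠ 0},
      k ≤ i.val.val → j.val.val < k → q H i > q H j)
    (hqH₃ : ∀ i j : {i : Fin (2 * k) // i.val ≠ 0},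
      i.val.val < k → j.val.val < k → i.val < j.val → q H i > q H j)
    (μ' : {i : Fin (2 * k) // i.val ≠ 0} → Option School)
    (hμ' : ∀ i, μ' i = if i.val.val < k then some H else some Y)
    (μ : Fin (2 * k) → Option School)
    (hμ : ∀ i, μ i = if i.val < k then some Y else some H) :
    -- μ' is feasible and exactly stable
    ((∀ u : School, (Finset.univ.filter fun i => μ' i = some u).card ≤ k) ∧
      (∀ (i : {i : Fin (2 * k) // i.val ≠ 0}) (u : School), μ' i ≠ some u →
        pref i (μ' i) (some u) ∨ ∀ j, μ' j = some u → q u j > q u i) ∧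
      (∀ u : School, (Finset.univ.filter fun i => μ' i = some u).card < k →
        ∀ i, μ' i ≠ some u → pref i (μ' i) (some u))) ∧
    -- μ' is the unique feasible and exactly stable matching
    (∀ σ : {i : Fin (2 * k) // i.val ≠ 0} → Option School,
      ((∀ u : School, (Finset.univ.filter fun i => σ i = some u).card ≤ k) ∧
        (∀ (i : {i : Fin (2 * k) // i.val ≠ 0}) (u : School), σ i ≠ some u →
          pref i (σ i) (some u) ∨ ∀ j, σ j = some u → q u j > q u i) ∧
        (∀ u : School, (Finset.univ.filter fun i => σ i = some u).card < k →
          ∀ i, σ i ≠ some u → pref i (σ i) (some u))) →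
      σ = μ') ∧
    -- removing s_1 changes the match of every remaining student
    (∀ i : {i : Fin (2 * k) // i.val ≠ 0}, μ' i ≠ μ i.val) := by
  have htopH : ∀ i, i.val.val < k → ∀ x, x ≠ some H → pref i (some H) x := by
    intro i hi x hx
    have := hpref i
    obtain ⟨h₁, h₂⟩ := hprefH i hi
    rcases x with _ | _ | _
    · exact _root_.trans h₁ h₂
    · exact absurd rfl hx
    · exact h₁
  have htopY : ∀ i, k ≤ i.val.val → ∀ x, x ≠ some Y → pref i (some Y) x := by
    intro i hi x hx
    have := hpref i
    obtain ⟨h₁, h₂⟩ := hprefY i hi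
    rcases x with _ | _ | _
    · exact _root_.trans h₁ h₂
    · exact h₁
    · exact absurd rfl hx
  have htop : ∀ i x, x ≠ μ' i → pref i (μ' i) x := by
    intro i x hx
    rw [hμ'] at hx ⊢
    split_ifs at hx ⊢ with hi
    · exact htopH i hi x hx
    · exact htopY i (not_lt.mp hi) x hx
  have hge := card_filter_le_index k hk
  have hlt := card_filter_index_lt k hk
  refine ⟨⟨?_, fun i u hu => Or.inl (htop i _ hu.symm), fun u _ i hu => htop i _ hu.symm⟩, ?_, ?_⟩
  · rintro (_ | _)
    · refine (Finset.card_le_card fun i => ?_).trans hlt.le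
      simp [hμ']
    · refine (Finset.card_le_card fun i => ?_).trans hge.le
      simp [hμ']
  · rintro σ ⟨hcap, -, hfree⟩
    have hfill : ∀ u, (Finset.univ.filter fun i => σ i = some u).card < k →
        ∀ i, μ' i = some u → σ i = some u := by
      intro u hu i hi
      by_contra hne
      have := hpref i
      have h := htop i (σ i) (hi ▸ hne)
      rw [hi] at h
      exact asymm h (hfree u hu i hne)
    have hYfull : (Finset.univ.filter fun i => σ i = some Y).card = k := by
      refine (hcap Y).antisymm (not_lt.mp fun hY => ?_)
      refine absurd (hge.ge.trans (Finset.card_le_card fun i hi => ?_)) (not_le.mpr hY)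
      simp only [Finset.mem_filter, Finset.mem_univ, true_and] at hi ⊢
      exact hfill Y hY i (by simp [hμ', hi])
    have hHfree : (Finset.univ.filter fun i => σ i = some H).card < k := by
      have hdisj : Disjoint (Finset.univ.filter fun i => σ i = some H)
          (Finset.univ.filter fun i => σ i = some Y) :=
        Finset.disjoint_filter.mpr fun i _ h₁ h₂ => by simp [h₁] at h₂
      have hunion := Finset.card_le_univ
        ((Finset.univ.filter fun i => σ i = some H) ∪ Finset.univ.filter fun i => σ i = some Y)
      rw [Finset.card_union_of_disjoint hdisj] at hunion
      have htotal := Finset.card_filter_add_card_filter_not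
        (s := (Finset.univ : Finset {i : Fin (2 * k) // i.val ≠ 0})) (fun i => i.val.val < k)
      simp only [not_lt] at htotal
      rw [Finset.card_univ] at htotal
      omega
    have hH : ∀ i, i.val.val < k → σ i = some H := fun i hi =>
      hfill H hHfree i (by simp [hμ', hi])
    have hYeq : (Finset.univ.filter fun i => σ i = some Y) =
        Finset.univ.filter fun i => k ≤ i.val.val := by
      refine Finset.eq_of_subset_of_card_le (fun i hi => ?_) (by rw [hge, hYfull])
      simp only [Finset.mem_filter, Finset.mem_univ, true_and] at hi ⊢
      by_contra hlt
      simp [hH i (not_le.mp hlt)] at hi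
    funext i
    rw [hμ']
    split_ifs with hi
    · exact hH i hi
    · have hmem : i ∈ Finset.univ.filter fun i => σ i = some Y := by
        rw [hYeq]
        simpa using hi
      simpa using hmem
  · intro i
    rw [hμ', hμ]
    split_ifs <;> simp
end
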